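/- Let a ∈ G_F, let H be a closed subset of G_F, and define μ(x) := min(a⁻¹x↑H) for x ∈ G (well-defined since a⁻¹x↑H is convex). Then for all x, y ∈ G: (i) if x ≤ y then μ(x) ≤ μ(y); (ii) μ(x ∧ y) ≤ μ(x) ∧ μ(y); (iii) if x ∨ y is finite, then μ(x ∨ y) = μ(x) ∨ μ(y). -/

import Mathlib

open Pointwise

namespace GraphGroupPaper

/-- The set of commutator relators: `gᵢ` and `gⱼ` commute for every pair of distinct
`i, j` with `{i,j} ∉ F`. -/
def Rels (k : ℕ) (F : Set (Sym2 (Fin k))) : Set (FreeGroup (Fin k)) :=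
  {w | ∃ i j : Fin k, i ≠ j ∧ s(i, j) ∉ F ∧
      w = FreeGroup.of i * FreeGroup.of j * (FreeGroup.of i)⁻¹ * (FreeGroup.of j)⁻¹}

/-- The graph group `G_F` with generators `g₁, …, g_k` and relations `gᵢgⱼ = gⱼgᵢ`
for all distinct `i, j` with `{i,j} ∉ F`. -/
abbrev Grp (k : ℕ) (F : Set (Sym2 (Fin k))) := PresentedGroup (Rels k F)

/-- The generator `gᵢ` of the graph group. -/
def gen (k : ℕ) (F : Set (Sym2 (Fin k))) (i : Fin k) : Grp k F :=
  PresentedGroup.of i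

/-- The group element corresponding to a symbol: `(i, true)` stands for `gᵢ`,
`(i, false)` stands for `gᵢ⁻¹`. -/
def sym (k : ℕ) (F : Set (Sym2 (Fin k))) (α : Fin k × Bool) : Grp k F :=
  if α.2 then gen k F α.1 else (gen k F α.1)⁻¹

/-- The product of the word `l` of symbols, as an element of the graph group. -/
def wordProd (k : ℕ) (F : Set (Sym2 (Fin k))) (l : List (Fin k × Bool)) : Grp k F :=
  (l.map (sym k F)).prod

/-- `|x|` : the length of a shortest word in the symbols representing `x`. -/
noncomputable def len {k : ℕ} {F : Set (Sym2 (Fin k))} (x : Grp k F) : ℕ :=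
  sInf {n | ∃ l : List (Fin k × Bool), wordProd k F l = x ∧ l.length = n}

/-- The partial order on `G_F`:  `x ≤ y` iff `|y| = |x| + |x⁻¹y|`. -/
def le {k : ℕ} {F : Set (Sym2 (Fin k))} (x y : Grp k F) : Prop :=
  len y = len x + len (x⁻¹ * y)

/-- `m` is the meet `x ∧ y` (greatest lower bound w.r.t. `le`). -/
def IsMeet {k : ℕ} {F : Set (Sym2 (Fin k))} (x y m : Grp k F) : Prop :=
  le m x ∧ le m y ∧ ∀ w, le w x → le w y → le w m

/-- `j` is the (finite) join `x ∨ y` (least upper bound w.r.t. `le`);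
`x ∨ y` is finite iff such a `j` exists. -/
def IsJoin {k : ℕ} {F : Set (Sym2 (Fin k))} (x y j : Grp k F) : Prop :=
  le x j ∧ le y j ∧ ∀ w, le x w → le y w → le j w

/-- `j` is the (finite) join of the set `S`. -/
def IsJoinSet {k : ℕ} {F : Set (Sym2 (Fin k))} (S : Set (Grp k F)) (j : Grp k F) : Prop :=
  (∀ s ∈ S, le s j) ∧ ∀ w, (∀ s ∈ S, le s w) → le j w

/-- `y` is a segment of `a` if `a = x·y·z` for some `x, z`. -/
def Segment {k : ℕ} {F : Set (Sym2 (Fin k))} (y a : Grp k F) : Prop :=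
  ∃ x z, a = x * y * z ∧ len a = len x + len y + len z

/-- The left-invariant metric `dist(x,y) = |x⁻¹y|`. -/
noncomputable def dist {k : ℕ} {F : Set (Sym2 (Fin k))} (x y : Grp k F) : ℕ :=
  len (x⁻¹ * y)

/-- A nonempty set `L` is convex if `x, z ∈ L` and `dist(x,y) + dist(y,z) = dist(x,z)`
imply `y ∈ L`. -/
def ConvexSet {k : ℕ} {F : Set (Sym2 (Fin k))} (L : Set (Grp k F)) : Prop :=
  L.Nonempty ∧ ∀ x z y : Grp k F, x ∈ L → z ∈ L →
    dist x y + dist y z = dist x z → y ∈ L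

/-- An ideal: nonempty, downward closed, and closed under finite joins. -/
def IdealSet {k : ℕ} {F : Set (Sym2 (Fin k))} (I : Set (Grp k F)) : Prop :=
  I.Nonempty ∧ (∀ x ∈ I, ∀ y, le y x → y ∈ I) ∧
    (∀ x ∈ I, ∀ y ∈ I, ∀ j, IsJoin x y j → j ∈ I)

/-- `H` is closed if both `H` and `H⁻¹` are ideals. -/
def ClosedSet {k : ℕ} {F : Set (Sym2 (Fin k))} (H : Set (Grp k F)) : Prop :=
  IdealSet H ∧ IdealSet H⁻¹

/-- `m` is a minimal element of `S` w.r.t. `le`. -/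
def MinimalIn {k : ℕ} {F : Set (Sym2 (Fin k))} (S : Set (Grp k F)) (m : Grp k F) : Prop :=
  m ∈ S ∧ ∀ x ∈ S, le x m → x = m

/-- `l` is a reduced (i.e. shortest) word representing `x`. -/
def MinWord {k : ℕ} {F : Set (Sym2 (Fin k))} (x : Grp k F) (l : List (Fin k × Bool)) : Prop :=
  wordProd k F l = x ∧ l.length = len x

open Classical in
/-- `#_α(x)`: the number of occurrences of the symbol `α` (not counting `α⁻¹`)
in a reduced word representing `x`. -/
noncomputable def symCount {k : ℕ} {F : Set (Sym2 (Fin k))} (α : Fin k × Bool)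
    (x : Grp k F) : ℕ :=
  if h : ∃ l, MinWord x l then h.choose.count α else 0

/-- The symbol `α` occurs in `x`. -/
def Occurs {k : ℕ} {F : Set (Sym2 (Fin k))} (α : Fin k × Bool) (x : Grp k F) : Prop :=
  0 < symCount α x

/-- `α` is a maximal symbol of `x`, i.e. `xα⁻¹ ≤ x`. -/
def MaxSym {k : ℕ} {F : Set (Sym2 (Fin k))} (α : Fin k × Bool) (x : Grp k F) : Prop :=
  le (x * (sym k F α)⁻¹) x

/-- A peak: an element with precisely one maximal symbol. -/
def IsPeak {k : ℕ} {F : Set (Sym2 (Fin k))} (p : Grp k F) : Prop :=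
  ∃! α : Fin k × Bool, MaxSym α p

/-- An `α`-peak: a peak whose unique maximal symbol is `α`. -/
def AlphaPeak {k : ℕ} {F : Set (Sym2 (Fin k))} (α : Fin k × Bool) (p : Grp k F) : Prop :=
  MaxSym α p ∧ ∀ β, MaxSym β p → β = α

/-- The set of generator indices occurring in `b`. -/
def Support {k : ℕ} {F : Set (Sym2 (Fin k))} (b : Grp k F) : Set (Fin k) :=
  {i | Occurs (i, true) b ∨ Occurs (i, false) b}

/-- `b` is connected: the generators occurring in `b` induce a connected subgraph of
the graph `([k], F)`. -/
def Conn {k : ℕ} {F : Set (Sym2 (Fin k))} (b : Grp k F) : Prop :=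
  (SimpleGraph.induce (Support b) (SimpleGraph.fromEdgeSet F)).Connected

/-- `b` is cyclically reduced: `b ∧ b⁻¹ = 1`. -/
def CycRed {k : ℕ} {F : Set (Sym2 (Fin k))} (b : Grp k F) : Prop :=
  IsMeet b b⁻¹ 1

section Walls

variable {k : ℕ} {F : Set (Sym2 (Fin k))}

/-- The subgroup generated by the generators distinct from and commuting with `gᵢ`. -/
def link (F : Set (Sym2 (Fin k))) (i : Fin k) : Subgroup (Grp k F) :=
  Subgroup.closure {g | ∃ j, i ≠ j ∧ s(i, j) ∉ F ∧ g = gen k F j}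

/-- The walls (hyperplanes) of the Cayley graph: the parallelism class of the edge
from `x` to `x gᵢ` is `⟨i, x · link i⟩`. -/
abbrev Wall (k : ℕ) (F : Set (Sym2 (Fin k))) := Σ i : Fin k, Grp k F ⧸ link F i

/-- The symbol inverse to `α`. -/
def flip (α : Fin k × Bool) : Fin k × Bool := (α.1, !α.2)

/-- The initial vertex of the positively oriented edge joining `1` and the symbol `α`. -/
def base (F : Set (Sym2 (Fin k))) (α : Fin k × Bool) : Grp k F :=
  if α.2 then 1 else (gen k F α.1)⁻¹

/-- The wall dual to the edge from `1` to the symbol `α`. -/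
def wall (F : Set (Sym2 (Fin k))) (α : Fin k × Bool) : Wall k F :=
  ⟨α.1, (QuotientGroup.mk (base F α))⟩

lemma gen_comm {i j : Fin k} (hij : i ≠ j) (hF : s(i, j) ∉ F) :
    gen k F i * gen k F j = gen k F j * gen k F i := by
  have h : (PresentedGroup.mk (Rels k F)) (FreeGroup.of i * FreeGroup.of j *
      (FreeGroup.of i)⁻¹ * (FreeGroup.of j)⁻¹) = 1 :=
    PresentedGroup.one_of_mem ⟨i, j, hij, hF, rfl⟩
  simp only [map_mul, map_inv] at h
  have h' : gen k F i * gen k F j * (gen k F i)⁻¹ * (gen k F j)⁻¹ = 1 := h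
  rw [mul_inv_eq_one, mul_inv_eq_iff_eq_mul] at h'
  exact h'

lemma gen_mem_link {i j : Fin k} (hij : i ≠ j) (hF : s(i, j) ∉ F) : gen k F j ∈ link F i :=
  Subgroup.subset_closure ⟨j, hij, hF, rfl⟩

lemma link_comm {i : Fin k} {l : Grp k F} (hl : l ∈ link F i) :
    Commute (gen k F i) l := by
  induction hl using Subgroup.closure_induction with
  | mem x hx =>
    obtain ⟨j, hij, hF, rfl⟩ := hx
    exact gen_comm hij hF
  | one => exact Commute.one_right _
  | mul x y _ _ hx hy => exact hx.mul_right hy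
  | inv x _ hx => exact hx.inv_right

lemma smul_sigma_mk (x y : Grp k F) (i : Fin k) :
    x • (⟨i, QuotientGroup.mk y⟩ : Wall k F) = ⟨i, QuotientGroup.mk (x * y)⟩ := rfl

/-- The affine permutation of sets of walls induced by a generator. -/
def genPerm (F : Set (Sym2 (Fin k))) (i : Fin k) : Equiv.Perm (Set (Wall k F)) where
  toFun S := symmDiff {wall F (i, true)} (gen k F i • S)
  invFun S := (gen k F i)⁻¹ • symmDiff {wall F (i, true)} S
  left_inv S := by simp
  right_inv S := by simp

lemma gen_smul_wall {i j : Fin k} (hij : i ≠ j) (hF : s(i, j) ∉ F) :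
    gen k F j • wall F (i, true) = wall F (i, true) := by
  simp only [wall, smul_sigma_mk]
  congr 1
  rw [QuotientGroup.eq]
  simpa [base] using gen_mem_link hij hF

lemma genPerm_comm {i j : Fin k} (hij : i ≠ j) (hF : s(i, j) ∉ F) :
    genPerm F i * genPerm F j = genPerm F j * genPerm F i := by
  ext1 S
  have hF' : s(j, i) ∉ F := by rwa [Sym2.eq_swap]
  simp only [genPerm, Equiv.Perm.coe_mul, Function.comp_apply, Equiv.coe_fn_mk,
    Set.smul_set_symmDiff, Set.smul_set_singleton, gen_smul_wall hij hF,
    gen_smul_wall hij.symm hF', smul_smul, gen_comm hij hF]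
  rw [← symmDiff_assoc, ← symmDiff_assoc, symmDiff_comm {wall F (i, true)}]

/-- The affine action of the graph group on sets of walls. -/
def wallAction (k : ℕ) (F : Set (Sym2 (Fin k))) : Grp k F →* Equiv.Perm (Set (Wall k F)) :=
  PresentedGroup.toGroup (f := genPerm F) (by
    rintro _ ⟨i, j, hij, hF, rfl⟩
    simp [genPerm_comm hij hF])

/-- The set of walls separating `1` from `x`. -/
def sep (x : Grp k F) : Set (Wall k F) := wallAction k F x ∅

lemma wallAction_gen (i : Fin k) : wallAction k F (gen k F i) = genPerm F i :=
  PresentedGroup.toGroup.of _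

lemma wallAction_apply (x : Grp k F) (S : Set (Wall k F)) :
    wallAction k F x S = symmDiff (sep x) (x • S) := by
  have hx : x ∈ Subgroup.closure (Set.range (PresentedGroup.of (rels := Rels k F))) := by
    rw [PresentedGroup.closure_range_of]; trivial
  unfold sep
  induction hx using Subgroup.closure_induction generalizing S with
  | mem x hx =>
    obtain ⟨i, rfl⟩ := hx
    change wallAction k F (gen k F i) S = symmDiff (wallAction k F (gen k F i) ∅) (gen k F i • S)
    rw [wallAction_gen]
    simp only [genPerm, Equiv.coe_fn_mk, Set.smul_set_empty]
    rw [← Set.bot_eq_empty, symmDiff_bot]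
  | one => simp [← Set.bot_eq_empty]
  | mul x y _ _ hx hy =>
    simp only [map_mul, Equiv.Perm.coe_mul, Function.comp_apply]
    rw [hx, hy, hx (wallAction k F y ∅), Set.smul_set_symmDiff, smul_smul, symmDiff_assoc]
  | inv x _ hx =>
    rw [map_inv, Equiv.Perm.inv_eq_iff_eq, hx, Set.smul_set_symmDiff, smul_inv_smul,
      ← symmDiff_assoc, ← hx]
    simp [← Set.bot_eq_empty]

lemma sep_one : sep (1 : Grp k F) = ∅ := by simp [sep]

lemma sep_mul (x y : Grp k F) : sep (x * y) = symmDiff (sep x) (x • sep y) := by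
  rw [← wallAction_apply]; simp [sep]

lemma mem_sep_mul {x y : Grp k F} {w : Wall k F} :
    w ∈ sep (x * y) ↔ ¬ (w ∈ sep x ↔ x⁻¹ • w ∈ sep y) := by
  rw [sep_mul, Set.mem_symmDiff, Set.mem_smul_set_iff_inv_smul_mem]; tauto

lemma mem_sep_inv_mul {x y : Grp k F} {w : Wall k F} :
    w ∈ sep (x⁻¹ * y) ↔ ¬ (x • w ∈ sep x ↔ x • w ∈ sep y) := by
  have h := mem_sep_mul (x := x) (y := x⁻¹ * y) (w := x • w)
  rw [mul_inv_cancel_left, inv_smul_smul] at h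
  tauto

lemma sep_gen (i : Fin k) : sep (gen k F i) = {wall F (i, true)} := by
  simp [sep, wallAction_gen, genPerm]

lemma sym_flip (α : Fin k × Bool) : sym k F (flip α) = (sym k F α)⁻¹ := by
  obtain ⟨i, b⟩ := α
  cases b <;> simp [sym, flip]

lemma sym_smul_wall_flip (α : Fin k × Bool) : sym k F α • wall F (flip α) = wall F α := by
  obtain ⟨i, b⟩ := α
  cases b <;> simp [sym, flip, wall, base]

lemma mem_sep_sym {α : Fin k × Bool} {w : Wall k F} :
    w ∈ sep (sym k F α) ↔ w = wall F α := by
  have key : ∀ i (w : Wall k F), w ∈ sep (gen k F i) ↔ w = wall F (i, true) := by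
    intro i w; rw [sep_gen]; rfl
  obtain ⟨i, b⟩ := α
  cases b with
  | true => exact key i w
  | false =>
    have h := mem_sep_inv_mul (x := gen k F i) (y := 1) (w := w)
    rw [mul_one, sep_one, key] at h
    have h2 : gen k F i • w = wall F (i, true) ↔ w = wall F (i, false) := by
      rw [← sym_smul_wall_flip (i, true)]
      exact smul_left_cancel_iff (gen k F i)
    change w ∈ sep (gen k F i)⁻¹ ↔ _
    rw [h, ← h2]
    simp

lemma mem_sep_mul_sym {x : Grp k F} {α : Fin k × Bool} {w : Wall k F} :
    w ∈ sep (x * sym k F α) ↔ ¬ (w ∈ sep x ↔ w = x • wall F α) := by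
  rw [mem_sep_mul, mem_sep_sym, inv_smul_eq_iff]

lemma type_of_mem_sep_link {i : Fin k} {l : Grp k F} (hl : l ∈ link F i) :
    ∀ w ∈ sep l, i ≠ w.1 ∧ s(i, w.1) ∉ F := by
  induction hl using Subgroup.closure_induction with
  | mem x hx =>
    obtain ⟨j, hij, hF, rfl⟩ := hx
    intro w hw
    rw [sep_gen] at hw
    obtain rfl := hw
    exact ⟨hij, hF⟩
  | one => simp [sep_one]
  | mul x y _ _ hx hy =>
    intro w hw
    by_cases h : w ∈ sep x
    · exact hx w h
    · exact hy (x⁻¹ • w) (by rw [mem_sep_mul] at hw; tauto)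
  | inv x _ hx =>
    intro w hw
    have h := mem_sep_inv_mul (x := x) (y := 1) (w := w)
    rw [mul_one, sep_one] at h
    exact hx (x • w) (by have := h.1 hw; simp at this; exact this)

lemma link_smul_wall {α : Fin k × Bool} {l : Grp k F} (hl : l ∈ link F α.1) :
    l • wall F α = wall F α := by
  obtain ⟨i, b⟩ := α
  simp only [wall, smul_sigma_mk]
  congr 1
  have hc := (link_comm hl).inv_left
  rw [QuotientGroup.eq, mul_inv_rev]
  cases b
  · have e : (base F (i, false))⁻¹ * l⁻¹ * base F (i, false) = l⁻¹ := by
      simp only [base, Bool.false_eq_true, if_false]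
      rw [mul_assoc, ← hc.inv_right.eq]; group
    simp only [mul_assoc] at e ⊢
    rw [e]
    exact inv_mem hl
  · simpa [base] using hl

/-- Two edges of the same wall crossed in the same direction carry the same symbol, and
their starting points differ by an element of the link. -/
lemma eq_of_smul_wall_eq {x y : Grp k F} {α β : Fin k × Bool}
    (h : x • wall F α = y • wall F β)
    (hxy : x • wall F α ∈ sep x ↔ x • wall F α ∈ sep y) :
    α = β ∧ x⁻¹ * y ∈ link F α.1 := by
  obtain ⟨i, b⟩ := α
  obtain ⟨i', b'⟩ := β
  have h0 := h
  simp only [wall, smul_sigma_mk, Sigma.mk.inj_iff] at h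
  obtain ⟨rfl, h⟩ := h
  have hm := QuotientGroup.eq.1 (eq_of_heq h)
  set l := (x * base F (i, b))⁻¹ * (y * base F (i, b')) with hl
  have hc := link_comm hm
  have hnl : ∀ c : Grp k F ⧸ link F i, (⟨i, c⟩ : Wall k F) ∉ sep l := fun c hcl =>
    (type_of_mem_sep_link hm _ hcl).1 rfl
  have same : b = b' → x⁻¹ * y = l := by
    rintro rfl
    cases b
    · have e : x⁻¹ * y = (gen k F i)⁻¹ * l * gen k F i := by simp [hl, base]; group
      rw [e, mul_assoc, ← hc.eq]; simp
    · simp [hl, base]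
  have diff : x⁻¹ * y ≠ l * sym k F (i, b) := by
    intro e
    have h1 := mem_sep_inv_mul (x := x) (y := y) (w := wall F (i, b))
    rw [e, mem_sep_mul_sym, link_smul_wall (α := (i, b)) hm] at h1
    have h2 : wall F (i, b) ∉ sep l := hnl _
    tauto
  have hb : b = b' := by
    by_contra hne
    refine diff ?_
    cases b <;> cases b' <;> simp at hne
    · simp only [hl, base, sym] at hc ⊢
      simp only [Bool.false_eq_true, if_false, if_true, mul_one] at hc ⊢
      rw [← hc.inv_left.eq]; group
    · simp [hl, base, sym, mul_assoc]
  exact ⟨by rw [hb], by rw [same hb]; exact hm⟩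

lemma sep_sym (α : Fin k × Bool) : sep (sym k F α) = {wall F α} := by
  ext w; exact mem_sep_sym

lemma wordProd_cons (α : Fin k × Bool) (l : List (Fin k × Bool)) :
    wordProd k F (α :: l) = sym k F α * wordProd k F l := by simp [wordProd]

lemma wordProd_append (l l' : List (Fin k × Bool)) :
    wordProd k F (l ++ l') = wordProd k F l * wordProd k F l' := by simp [wordProd]

lemma exists_wordProd_eq (x : Grp k F) : ∃ l, wordProd k F l = x := by
  have hx : x ∈ Subgroup.closure (Set.range (PresentedGroup.of (rels := Rels k F))) := by
    rw [PresentedGroup.closure_range_of]; trivial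
  induction hx using Subgroup.closure_induction'' with
  | mem x hx =>
    obtain ⟨i, rfl⟩ := hx
    exact ⟨[(i, true)], by simp [wordProd, sym, gen]⟩
  | inv_mem x hx =>
    obtain ⟨i, rfl⟩ := hx
    exact ⟨[(i, false)], by simp [wordProd, sym, gen]⟩
  | one => exact ⟨[], rfl⟩
  | mul x y _ _ hx hy =>
    obtain ⟨l, rfl⟩ := hx
    obtain ⟨l', rfl⟩ := hy
    exact ⟨l ++ l', wordProd_append l l'⟩

lemma exists_minWord (x : Grp k F) : ∃ l, MinWord x l := by
  obtain ⟨l, hl⟩ := exists_wordProd_eq x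
  exact Nat.sInf_mem (s := {n | ∃ l, wordProd k F l = x ∧ l.length = n}) ⟨_, l, hl, rfl⟩

lemma len_wordProd_le (l : List (Fin k × Bool)) : len (wordProd k F l) ≤ l.length :=
  Nat.sInf_le ⟨l, rfl, rfl⟩

/-- A wall separating `1` from the end of a word is crossed by the word for a last time. -/
lemma exists_last_crossing (l : List (Fin k × Bool)) (w : Wall k F)
    (hw : w ∈ sep (wordProd k F l)) :
    ∃ l₁ β l₂, l = l₁ ++ β :: l₂ ∧ w = wordProd k F l₁ • wall F β ∧
      w ∈ sep (wordProd k F l₁ * sym k F β) := by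
  induction l generalizing w with
  | nil => simp [wordProd, sep_one] at hw
  | cons γ l ih =>
    rw [wordProd_cons] at hw
    by_cases h : (sym k F γ)⁻¹ • w ∈ sep (wordProd k F l)
    · obtain ⟨l₁, β, l₂, rfl, h1, h2⟩ := ih _ h
      refine ⟨γ :: l₁, β, l₂, rfl, ?_, ?_⟩
      · rw [wordProd_cons, mul_smul, ← h1, smul_inv_smul]
      · rw [mem_sep_mul] at hw
        rw [wordProd_cons, mul_assoc, mem_sep_mul]
        tauto
    · rw [mem_sep_mul] at hw
      have hw' : w ∈ sep (sym k F γ) := by tauto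
      refine ⟨[], γ, l, rfl, ?_, ?_⟩
      · simpa [wordProd] using mem_sep_sym.1 hw'
      · simpa [wordProd] using hw'

lemma commute_sym_link {α : Fin k × Bool} {l : Grp k F} (hl : l ∈ link F α.1) :
    Commute (sym k F α) l := by
  obtain ⟨i, b⟩ := α
  cases b
  · simpa [sym] using (link_comm hl).inv_left
  · simpa [sym] using link_comm hl

lemma notMem_sep_of_len {y : Grp k F} {α : Fin k × Bool} (h : len (y * sym k F α) = len y + 1) :
    y • wall F α ∉ sep y := by
  intro hw
  obtain ⟨l, rfl, hl⟩ := exists_minWord y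
  obtain ⟨l₁, β, l₂, rfl, h1, h2⟩ := exists_last_crossing l _ hw
  set u := wordProd k F l₁
  set v := wordProd k F l₂
  have hy : wordProd k F (l₁ ++ β :: l₂) = u * sym k F β * v := by
    rw [wordProd_append, wordProd_cons, mul_assoc]
  rw [hy] at h hw hl h1 h2
  have h3 : (u * sym k F β) • wall F (flip β) = (u * sym k F β * v) • wall F α := by
    rw [mul_smul, sym_smul_wall_flip, h1]
  obtain ⟨rfl, h4⟩ := eq_of_smul_wall_eq h3 (by rw [h3]; tauto)
  rw [inv_mul_cancel_left] at h4
  have h5 : u * sym k F β * v * sym k F (flip β) = wordProd k F (l₁ ++ l₂) := by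
    have hc : Commute (sym k F β) v := commute_sym_link h4
    rw [mul_assoc u, hc.eq, sym_flip, wordProd_append]
    group
    rfl
  have := len_wordProd_le (F := F) (l₁ ++ l₂)
  rw [← h5] at this
  simp at this hl
  omega

lemma sep_mul_sym {y : Grp k F} {α : Fin k × Bool} (h : y • wall F α ∉ sep y) :
    sep (y * sym k F α) = insert (y • wall F α) (sep y) := by
  ext w
  rw [mem_sep_mul_sym, Set.mem_insert_iff]
  by_cases hw : w = y • wall F α
  · subst hw; tauto
  · tauto

lemma exists_eq_mul_sym {x : Grp k F} {n : ℕ} (h : len x = n + 1) :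
    ∃ y α, x = y * sym k F α ∧ len y = n := by
  obtain ⟨l, rfl, hl⟩ := exists_minWord x
  have hne : l ≠ [] := by rintro rfl; simp at hl; omega
  obtain ⟨l', α, rfl⟩ : ∃ l' α, l = l' ++ [α] := ⟨_, _, (List.dropLast_append_getLast hne).symm⟩
  refine ⟨wordProd k F l', α, by simp [wordProd], ?_⟩
  have h1 := len_wordProd_le (F := F) l'
  obtain ⟨m, hm, hm'⟩ := exists_minWord (wordProd k F l')
  have h2 := len_wordProd_le (F := F) (m ++ [α])
  rw [wordProd_append, hm, ← wordProd_append] at h2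
  simp at hl h2
  omega

lemma eq_one_of_len {x : Grp k F} (h : len x = 0) : x = 1 := by
  obtain ⟨l, rfl, hl⟩ := exists_minWord x
  rw [h, List.length_eq_zero_iff] at hl
  simp [hl, wordProd]

lemma sep_finite_and_ncard (x : Grp k F) : (sep x).Finite ∧ (sep x).ncard = len x := by
  induction hn : len x generalizing x with
  | zero => simp [eq_one_of_len hn, sep_one]
  | succ n ih =>
    obtain ⟨y, α, rfl, hy⟩ := exists_eq_mul_sym hn
    obtain ⟨h1, h2⟩ := ih y hy
    have h3 : y • wall F α ∉ sep y := notMem_sep_of_len (by omega)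
    rw [sep_mul_sym h3]
    exact ⟨h1.insert _, by rw [Set.ncard_insert_of_notMem h3 h1, h2]⟩

lemma sep_finite (x : Grp k F) : (sep x).Finite := (sep_finite_and_ncard x).1

/-- The length of `x` is the number of walls separating it from `1`. -/
lemma ncard_sep (x : Grp k F) : (sep x).ncard = len x := (sep_finite_and_ncard x).2

lemma sep_inv_mul (x y : Grp k F) : sep (x⁻¹ * y) = x⁻¹ • symmDiff (sep x) (sep y) := by
  ext w
  rw [mem_sep_inv_mul, Set.mem_smul_set_iff_inv_smul_mem, inv_inv, Set.mem_symmDiff]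
  tauto

lemma len_inv_mul (x y : Grp k F) : len (x⁻¹ * y) = (symmDiff (sep x) (sep y)).ncard := by
  rw [← ncard_sep, sep_inv_mul, Set.ncard_smul_set]

lemma le_iff_sep_subset {x y : Grp k F} : le x y ↔ sep x ⊆ sep y := by
  unfold le
  rw [len_inv_mul, ← ncard_sep x, ← ncard_sep y]
  have hx := sep_finite x
  have hy := sep_finite y
  have e : (symmDiff (sep x) (sep y)).ncard = (sep x \ sep y).ncard + (sep y \ sep x).ncard :=
    Set.ncard_union_eq disjoint_sdiff_sdiff (hx.sdiff) (hy.sdiff)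
  have e1 := Set.ncard_inter_add_ncard_sdiff_eq_ncard (sep x) (sep y) hx
  have e2 := Set.ncard_inter_add_ncard_sdiff_eq_ncard (sep y) (sep x) hy
  rw [Set.inter_comm] at e2
  rw [← Set.sdiff_eq_empty, ← Set.ncard_eq_zero hx.sdiff]
  omega

lemma sep_injective : Function.Injective (sep : Grp k F → Set (Wall k F)) := by
  intro x y h
  have := len_inv_mul x y
  rw [h, symmDiff_self, Set.bot_eq_empty, Set.ncard_empty] at this
  exact (inv_mul_eq_one.1 (eq_one_of_len this))

lemma wall_injective : Function.Injective (wall F : Fin k × Bool → Wall k F) := by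
  intro α β h
  refine (eq_of_smul_wall_eq (x := (1 : Grp k F)) (y := 1) (by simpa using h) Iff.rfl).1

/-- A wall separating `1` from `x` is crossed by a geodesic from `1` to `x`. -/
lemma exists_crossing {x : Grp k F} {w : Wall k F} (hw : w ∈ sep x) :
    ∃ u β, sep u ⊆ sep x ∧ w = u • wall F β ∧ w ∉ sep u := by
  induction hn : len x generalizing x with
  | zero => simp [eq_one_of_len hn, sep_one] at hw
  | succ n ih =>
    obtain ⟨y, α, rfl, hy⟩ := exists_eq_mul_sym hn
    have h3 : y • wall F α ∉ sep y := notMem_sep_of_len (by omega)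
    rw [sep_mul_sym h3] at hw ⊢
    by_cases h : w ∈ sep y
    · obtain ⟨u, β, h1, h2⟩ := ih h hy
      exact ⟨u, β, h1.trans (Set.subset_insert _ _), h2⟩
    · have hw' : w = y • wall F α := by simpa [h] using hw
      exact ⟨y, α, Set.subset_insert _ _, hw', h⟩

/-- Distinct symbols with a common upper bound commute. -/
lemma adj_of_mem_sep {α β : Fin k × Bool} {z : Grp k F} (hα : wall F α ∈ sep z)
    (hβ : wall F β ∈ sep z) (hne : α ≠ β) : β.1 ≠ α.1 ∧ s(β.1, α.1) ∉ F := by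
  have hw : wall F β ≠ wall F α := fun h => hne (wall_injective h).symm
  have hc : (sym k F α) • (sym k F α)⁻¹ • wall F β = wall F β := smul_inv_smul _ _
  have h1 : (sym k F α)⁻¹ • wall F β ∈ sep ((sym k F α)⁻¹ * z) := by
    rw [mem_sep_inv_mul, hc, mem_sep_sym]
    tauto
  obtain ⟨u, γ, hu, h2, h3⟩ := exists_crossing h1
  have h4 : wall F β ∉ sep (sym k F α * u) := by
    rw [mem_sep_mul, mem_sep_sym]; tauto
  have h5 : wall F α ∈ sep (sym k F α * u) := by
    rw [mem_sep_mul, mem_sep_sym]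
    have : (sym k F α)⁻¹ • wall F α ∉ sep u := by
      intro h
      have := hu h
      rw [mem_sep_inv_mul, smul_inv_smul, mem_sep_sym] at this
      tauto
    tauto
  have h6 : (1 : Grp k F) • wall F β = (sym k F α * u) • wall F γ := by
    rw [one_smul, mul_smul, ← h2, hc]
  obtain ⟨rfl, h7⟩ := eq_of_smul_wall_eq h6 (by rw [one_smul, sep_one]; simpa using h4)
  rw [inv_one, one_mul] at h7
  exact type_of_mem_sep_link h7 _ h5

lemma sym_mem_link {i : Fin k} {α : Fin k × Bool} (h : i ≠ α.1) (hF : s(i, α.1) ∉ F) :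
    sym k F α ∈ link F i := by
  obtain ⟨j, b⟩ := α
  cases b
  · simpa [sym] using gen_mem_link h hF
  · simpa [sym] using gen_mem_link h hF

/-- If a wall separates `1` from both `x` and `z`, then `x` and `z` have a common first symbol. -/
lemma exists_common_sym {x z : Grp k F} {w : Wall k F} (hx : w ∈ sep x) (hz : w ∈ sep z) :
    ∃ α, wall F α ∈ sep x ∧ wall F α ∈ sep z := by
  obtain ⟨u, β, hu, rfl, h⟩ := exists_crossing hx
  induction hn : len u generalizing u β with
  | zero =>
    obtain rfl := eq_one_of_len hn
    exact ⟨β, by simpa using hx, by simpa using hz⟩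
  | succ n ih =>
    obtain ⟨v, γ, rfl, hv⟩ := exists_eq_mul_sym hn
    have h3 : v • wall F γ ∉ sep v := notMem_sep_of_len (by omega)
    have h4 : v • wall F γ ∈ sep (v * sym k F γ) := by
      rw [sep_mul_sym h3]; exact Set.mem_insert _ _
    have hvu : sep v ⊆ sep (v * sym k F γ) := by
      rw [sep_mul_sym h3]; exact Set.subset_insert _ _
    by_cases h5 : v • wall F γ ∈ sep z
    · exact ih v γ (hvu.trans hu) (hu h4) h5 h3 hv
    · have h6 : (v * sym k F γ) • wall F (flip γ) = v • wall F γ := by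
        rw [mul_smul, sym_smul_wall_flip]
      have h7 : wall F (flip γ) ∈ sep ((v * sym k F γ)⁻¹ * z) := by
        rw [mem_sep_inv_mul, h6]; tauto
      have h8 : wall F β ∈ sep ((v * sym k F γ)⁻¹ * z) := by
        rw [mem_sep_inv_mul]; tauto
      have h9 : flip γ ≠ β := by
        rintro rfl
        rw [h6] at h
        exact h h4
      obtain ⟨h10, h11⟩ := adj_of_mem_sep h7 h8 h9
      have h12 : (v * sym k F γ) • wall F β = v • wall F β := by
        rw [mul_smul, link_smul_wall (sym_mem_link (α := γ) h10 h11)]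
      rw [h12] at hx hz h
      exact ih v β (hvu.trans hu) hx hz (fun h' => h (hvu h')) hv

lemma exists_meet (x z : Grp k F) : ∃ m : Grp k F, sep m = sep x ∩ sep z := by
  have key : ∀ n, ∀ m : Grp k F, sep m ⊆ sep x ∩ sep z → ((sep x ∩ sep z) \ sep m).ncard = n →
      ∃ m : Grp k F, sep m = sep x ∩ sep z := by
    intro n
    induction n using Nat.strong_induction_on with
    | _ n ih =>
      intro m hm hn
      by_cases h : sep x ∩ sep z ⊆ sep m
      · exact ⟨m, hm.antisymm h⟩
      · obtain ⟨w, hw, hwm⟩ := Set.not_subset.1 h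
        have hmw : m • m⁻¹ • w = w := smul_inv_smul _ _
        obtain ⟨α, h1, h2⟩ := exists_common_sym (x := m⁻¹ * x) (z := m⁻¹ * z) (w := m⁻¹ • w)
          (by rw [mem_sep_inv_mul, hmw]; have := hw.1; tauto)
          (by rw [mem_sep_inv_mul, hmw]; have := hw.2; tauto)
        rw [mem_sep_inv_mul] at h1 h2
        have hmx := @hm (m • wall F α)
        rw [Set.mem_inter_iff] at hmx
        have h3 : m • wall F α ∉ sep m := by tauto
        have h4 : m • wall F α ∈ sep x ∩ sep z := by rw [Set.mem_inter_iff]; tauto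
        refine ih _ ?_ (m * sym k F α) ?_ rfl
        · rw [← hn, sep_mul_sym h3]
          refine Set.ncard_lt_ncard ?_ ((sep_finite x).inter_of_left _).sdiff
          refine ⟨fun v hv => ⟨hv.1, fun h => hv.2 (Or.inr h)⟩, fun h => ?_⟩
          exact (h ⟨h4, h3⟩).2 (Or.inl rfl)
        · rw [sep_mul_sym h3]
          exact Set.insert_subset h4 hm
  exact key _ 1 (by simp [sep_one]) rfl

/-- Three elements have a median, lying on the majority side of every wall. -/
lemma exists_median (x y z : Grp k F) : ∃ m : Grp k F, ∀ w, w ∈ sep m ↔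
    (w ∈ sep x ∧ w ∈ sep y) ∨ (w ∈ sep x ∧ w ∈ sep z) ∨ (w ∈ sep y ∧ w ∈ sep z) := by
  obtain ⟨m, hm⟩ := exists_meet (y⁻¹ * x) (y⁻¹ * z)
  refine ⟨y * m, fun w => ?_⟩
  rw [mem_sep_mul, hm, Set.mem_inter_iff, mem_sep_inv_mul, mem_sep_inv_mul, smul_inv_smul]
  tauto

/-- `y` lies on a geodesic from `x` to `z`. -/
def Between (x y z : Grp k F) : Prop :=
  ∀ w : Wall k F, (w ∈ sep x → w ∈ sep z → w ∈ sep y) ∧ (w ∈ sep y → w ∈ sep x ∨ w ∈ sep z)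

/-- `S` contains every element lying between two of its elements. -/
def WallConvex (S : Set (Grp k F)) : Prop :=
  ∀ x ∈ S, ∀ z ∈ S, ∀ y, Between x y z → y ∈ S

lemma IdealSet.mem_of_le {I : Set (Grp k F)} (hI : IdealSet I) {x y : Grp k F} (hx : x ∈ I)
    (h : sep y ⊆ sep x) : y ∈ I :=
  hI.2.1 x hx y (le_iff_sep_subset.2 h)

lemma IdealSet.mem_of_subset_union {I : Set (Grp k F)} (hI : IdealSet I) {x y z : Grp k F}
    (hx : x ∈ I) (hz : z ∈ I) (h : sep y ⊆ sep x ∪ sep z) : y ∈ I := by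
  obtain ⟨m, hm⟩ := exists_meet x y
  obtain ⟨n, hn⟩ := exists_meet z y
  have hmI : m ∈ I := hI.mem_of_le hx (hm ▸ Set.inter_subset_left)
  have hnI : n ∈ I := hI.mem_of_le hz (hn ▸ Set.inter_subset_left)
  refine hI.2.2 m hmI n hnI y ⟨le_iff_sep_subset.2 (hm ▸ Set.inter_subset_right),
    le_iff_sep_subset.2 (hn ▸ Set.inter_subset_right), fun v hv1 hv2 => ?_⟩
  rw [le_iff_sep_subset] at *
  rw [hm] at hv1
  rw [hn] at hv2
  intro w hw
  rcases h hw with h' | h'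
  · exact hv1 ⟨h', hw⟩
  · exact hv2 ⟨h', hw⟩

lemma eq_mul_sym_of_symmDiff {x y : Grp k F} {w : Wall k F}
    (h : ∀ v, ¬ (v ∈ sep x ↔ v ∈ sep y) ↔ v = w) :
    ∃ α, y = x * sym k F α ∧ w = x • wall F α := by
  have h1 : sep (x⁻¹ * y) = {x⁻¹ • w} := by
    ext v
    rw [mem_sep_inv_mul, h, Set.mem_singleton_iff, eq_inv_smul_iff]
  have h2 : len (x⁻¹ * y) = 0 + 1 := by rw [← ncard_sep, h1, Set.ncard_singleton]
  obtain ⟨u, α, h3, h4⟩ := exists_eq_mul_sym h2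
  rw [eq_one_of_len h4, one_mul] at h3
  refine ⟨α, by rw [← h3, mul_inv_cancel_left], ?_⟩
  rw [h3, sep_sym, Set.singleton_eq_singleton_iff] at h1
  rw [h1, smul_inv_smul]

/-- Opposite sides of a rectangle carry the same group element. -/
lemma inv_mul_eq_of_rectangle {a b c e : Grp k F}
    (h : ∀ w : Wall k F, ((w ∈ sep a ↔ w ∈ sep b) ∧ (w ∈ sep c ↔ w ∈ sep e)) ∨
      ((w ∈ sep a ↔ w ∈ sep c) ∧ (w ∈ sep b ↔ w ∈ sep e))) : a⁻¹ * b = c⁻¹ * e := by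
  induction hn : len (b⁻¹ * a) generalizing a b c e with
  | zero =>
    have hba := inv_mul_eq_one.1 (eq_one_of_len hn)
    subst hba
    have hce : c = e := sep_injective (by ext w; have := h w; tauto)
    subst hce
    simp
  | succ n ih =>
    obtain ⟨y, α, h1, h2⟩ := exists_eq_mul_sym hn
    have ha : a = b * y * sym k F α := by rw [mul_assoc, ← h1, mul_inv_cancel_left]
    have hlen : len (y * sym k F α) = len y + 1 := by rw [← h1, hn, h2]
    have h3 := notMem_sep_of_len hlen
    set b₁ := b * y with hb₁
    set w₀ := b₁ • wall F α with hw₀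
    have hab₁ : ∀ v, ¬ (v ∈ sep a ↔ v ∈ sep b₁) ↔ v = w₀ := by
      intro v
      rw [ha, mem_sep_mul_sym, ← hw₀]
      tauto
    have hbb₁ : w₀ ∈ sep b₁ ↔ w₀ ∈ sep b := by
      rw [hb₁, mem_sep_mul, hw₀, hb₁, mul_smul, inv_smul_smul]
      tauto
    obtain ⟨f, hf⟩ := exists_median b₁ c e
    have hfc : ∀ v, ¬ (v ∈ sep c ↔ v ∈ sep f) ↔ v = w₀ := by
      intro v
      have e1 := hab₁ v
      have e2 := hf v
      have e3 := h v
      clear_value w₀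
      clear ih h hab₁ hf
      grind
    have haf : w₀ ∈ sep a ↔ w₀ ∈ sep c := by
      have e1 := hab₁ w₀
      have e3 := h w₀
      tauto
    obtain ⟨β, hβ, hβ'⟩ := eq_mul_sym_of_symmDiff hab₁
    obtain ⟨γ, hγ, hγ'⟩ := eq_mul_sym_of_symmDiff hfc
    obtain ⟨rfl, -⟩ := eq_of_smul_wall_eq (hβ'.symm.trans hγ') (by rw [← hβ']; exact haf)
    have hrec : b₁⁻¹ * b = f⁻¹ * e := by
      refine ih (fun w => ?_) ?_
      · have e1 := hab₁ w
        have e2 := hf w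
        have e3 := h w
        clear_value w₀
        clear ih h hab₁ hf hfc
        grind
      · rw [hb₁, inv_mul_cancel_left, h2]
    calc a⁻¹ * b = sym k F β * (b₁⁻¹ * b) := by rw [hβ]; group
      _ = c⁻¹ * e := by rw [hrec, hγ]; group

/-- A nonempty convex set contains a gate for every element `y`. -/
lemma WallConvex.exists_gate {C : Set (Grp k F)} (hC : WallConvex C) (hne : C.Nonempty)
    (y : Grp k F) : ∃ p ∈ C, ∀ c ∈ C, Between y p c := by
  obtain ⟨p, hp, hmin⟩ := WellFounded.has_min
    (InvImage.wf (fun c : Grp k F => len (y⁻¹ * c)) Nat.lt_wfRel.wf) C hne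
  refine ⟨p, hp, fun c hc => ?_⟩
  obtain ⟨m, hm⟩ := exists_median y p c
  have hmC : m ∈ C := hC p hp c hc m (fun w => by have := hm w; tauto)
  have hsub : sep (y⁻¹ * m) ⊆ sep (y⁻¹ * p) := by
    intro w
    rw [mem_sep_inv_mul, mem_sep_inv_mul, hm]
    tauto
  have hle := hmin m hmC
  have heq : sep (y⁻¹ * m) = sep (y⁻¹ * p) := by
    refine Set.eq_of_subset_of_ncard_le hsub ?_ (sep_finite _)
    rw [ncard_sep, ncard_sep]
    exact not_lt.1 hle
  have : m = p := mul_left_cancel (sep_injective heq)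
  subst this
  intro w
  have := hm w
  tauto

/-- The product of a convex set `C` with the inverse of a closed set `K` is convex. -/
lemma WallConvex.mul_closed {C K : Set (Grp k F)} (hC : WallConvex C) (hK : IdealSet K)
    (hK' : IdealSet K⁻¹) : WallConvex {z | ∃ h ∈ K, z * h ∈ C} := by
  rintro z₁ ⟨k₁, hk₁, hz₁⟩ z₂ ⟨k₂, hk₂, hz₂⟩ y hy
  obtain ⟨p, hp, hgate⟩ := hC.exists_gate ⟨_, hz₁⟩ y
  have key : ∀ z h a : Grp k F, h ∈ K → z * h ∈ C → (∀ w, w ∈ sep a ↔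
      (w ∈ sep y ∧ w ∈ sep z) ∨ (w ∈ sep y ∧ w ∈ sep p) ∨ (w ∈ sep z ∧ w ∈ sep p)) →
      p⁻¹ * a ∈ K⁻¹ := by
    intro z h a hh hzh ha
    obtain ⟨e, he⟩ := exists_median z (z * h) p
    obtain ⟨b, hb⟩ := exists_median y e z
    have heC : e ∈ C := hC _ hzh _ hp e (fun w => by have := he w; tauto)
    have heK : z⁻¹ * e ∈ K := by
      refine hK.mem_of_le hh (fun w hw => ?_)
      rw [mem_sep_inv_mul, he] at hw
      have e1 : w ∈ sep (z⁻¹ * (z * h)) := by rw [mem_sep_inv_mul]; tauto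
      rwa [inv_mul_cancel_left] at e1
    have hbK : e⁻¹ * b ∈ K⁻¹ := by
      refine hK'.mem_of_le (x := e⁻¹ * z) (by simpa using heK) (fun w => ?_)
      rw [mem_sep_inv_mul, mem_sep_inv_mul, hb]
      tauto
    have hrect : p⁻¹ * a = e⁻¹ * b := by
      refine inv_mul_eq_of_rectangle (fun w => ?_)
      have e1 := ha w
      have e2 := hb w
      have e3 := he w
      have e4 := hgate e heC w
      clear ha hb he hgate hy heK hbK
      grind
    rwa [hrect]
  obtain ⟨a₁, ha₁⟩ := exists_median y z₁ p
  obtain ⟨a₂, ha₂⟩ := exists_median y z₂ p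
  have hpy : p⁻¹ * y ∈ K⁻¹ := by
    refine hK'.mem_of_subset_union (key _ _ _ hk₁ hz₁ ha₁) (key _ _ _ hk₂ hz₂ ha₂) (fun w => ?_)
    rw [Set.mem_union, mem_sep_inv_mul, mem_sep_inv_mul, mem_sep_inv_mul, ha₁, ha₂]
    have := hy (p • w)
    tauto
  exact ⟨y⁻¹ * p, by simpa using hpy, by rwa [mul_inv_cancel_left]⟩

lemma WallConvex.le_of_minimalIn {S : Set (Grp k F)} (hS : WallConvex S) {m s : Grp k F}
    (hm : MinimalIn S m) (hs : s ∈ S) : le m s := by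
  obtain ⟨n, hn⟩ := exists_meet m s
  have hnS : n ∈ S := hS m hm.1 s hs n (fun w => by simp only [hn, Set.mem_inter_iff]; tauto)
  have := hm.2 n hnS (le_iff_sep_subset.2 (hn ▸ Set.inter_subset_left))
  rw [le_iff_sep_subset, ← this, hn]
  exact Set.inter_subset_right

lemma wallConvex_translate_upper (a x : Grp k F) : WallConvex {c | le x (a * c)} := by
  intro b hb c hc d hd
  simp only [Set.mem_ofPred_eq, le_iff_sep_subset] at *
  intro w hw
  have h1 := hb hw
  have h2 := hc hw
  rw [mem_sep_mul] at *
  have := hd (a⁻¹ • w)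
  tauto

lemma mem_upper_mul_iff {a x z : Grp k F} {H : Set (Grp k F)} :
    (∃ b h, le x b ∧ h ∈ H ∧ z = a⁻¹ * (b * h)) ↔ ∃ h ∈ H⁻¹, le x (a * (z * h)) := by
  constructor
  · rintro ⟨b, h, hb, hh, rfl⟩
    refine ⟨h⁻¹, by simpa using hh, ?_⟩
    convert hb using 1
    group
  · rintro ⟨h, hh, hx⟩
    exact ⟨a * (z * h), h⁻¹, hx, hh, by group⟩

end Walls

/-- the function `μ(x) = min(a⁻¹x↑H)` is monotone, submultiplicative
on meets, and preserves finite joins. -/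
theorem stmt11 {k : ℕ} (hk : 1 ≤ k) {F : Set (Sym2 (Fin k))}
    (a : Grp k F) (H : Set (Grp k F)) (hH : ClosedSet H)
    (μ : Grp k F → Grp k F)
    (hμ : ∀ x : Grp k F,
      MinimalIn {w | ∃ b h, le x b ∧ h ∈ H ∧ w = a⁻¹ * (b * h)} (μ x)) :
    (∀ x y, le x y → le (μ x) (μ y)) ∧
    (∀ x y m m', IsMeet x y m → IsMeet (μ x) (μ y) m' → le (μ m) m') ∧
    (∀ x y j, IsJoin x y j → IsJoin (μ x) (μ y) (μ j)) := by
  have hK : IdealSet H⁻¹ := hH.2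
  have hK' : IdealSet H⁻¹⁻¹ := by rw [inv_inv]; exact hH.1
  set S : Grp k F → Set (Grp k F) := fun x => {z | ∃ h ∈ H⁻¹, z * h ∈ {c | le x (a * c)}} with hS
  have hconv : ∀ x, WallConvex (S x) := fun x => (wallConvex_translate_upper a x).mul_closed hK hK'
  have hmin : ∀ x, MinimalIn (S x) (μ x) := by
    intro x
    have h := hμ x
    simp only [mem_upper_mul_iff] at h
    exact h
  have hanti : ∀ x y, le x y → S y ⊆ S x := by
    rintro x y hxy z ⟨h, hh, hz⟩
    exact ⟨h, hh, le_iff_sep_subset.2 ((le_iff_sep_subset.1 hxy).trans (le_iff_sep_subset.1 hz))⟩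
  have hmono : ∀ x y, le x y → le (μ x) (μ y) := fun x y hxy =>
    (hconv x).le_of_minimalIn (hmin x) (hanti x y hxy (hmin y).1)
  refine ⟨hmono, fun x y m m' hm hm' => hm'.2.2 _ (hmono _ _ hm.1) (hmono _ _ hm.2.1),
    fun x y j hj => ⟨hmono _ _ hj.1, hmono _ _ hj.2.1, fun u hxu hyu => ?_⟩⟩
  obtain ⟨v, hv⟩ := exists_meet u (μ j)
  have hmem : ∀ t, le t j → le (μ t) u → v ∈ S t := by
    intro t htj htu
    refine hconv t _ (hmin t).1 _ (hanti t j htj (hmin j).1) v (fun w => ?_)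
    have h1 : w ∈ sep (μ t) → w ∈ sep u := fun hw => le_iff_sep_subset.1 htu hw
    rw [hv, Set.mem_inter_iff]
    tauto
  obtain ⟨k₁, hk₁, h₁⟩ := hmem x hj.1 hxu
  obtain ⟨k₂, hk₂, h₂⟩ := hmem y hj.2.1 hyu
  obtain ⟨c, hc⟩ := exists_median (v * k₁) (v * k₂) (a⁻¹ * j)
  have hvc : v⁻¹ * c ∈ H⁻¹ := by
    refine hK.mem_of_subset_union hk₁ hk₂ (fun w hw => ?_)
    rw [mem_sep_inv_mul, hc, mem_sep_mul, mem_sep_mul, inv_smul_smul] at hw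
    rw [Set.mem_union]
    tauto
  have hac : ∀ w, w ∈ sep (a * c) ↔ (w ∈ sep (a * (v * k₁)) ∧ w ∈ sep (a * (v * k₂))) ∨
      (w ∈ sep (a * (v * k₁)) ∧ w ∈ sep j) ∨ (w ∈ sep (a * (v * k₂)) ∧ w ∈ sep j) := by
    intro w
    rw [mem_sep_mul, hc, mem_sep_inv_mul, smul_inv_smul, mem_sep_mul (x := a) (y := v * k₁),
      mem_sep_mul (x := a) (y := v * k₂)]
    clear hc hvc hv hmem
    grind
  have hjc : le j (a * c) := by
    refine hj.2.2 _ (le_iff_sep_subset.2 fun w hw => ?_) (le_iff_sep_subset.2 fun w hw => ?_)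
    · exact (hac w).2 (Or.inr (Or.inl ⟨le_iff_sep_subset.1 h₁ hw, le_iff_sep_subset.1 hj.1 hw⟩))
    · exact (hac w).2 (Or.inr (Or.inr ⟨le_iff_sep_subset.1 h₂ hw, le_iff_sep_subset.1 hj.2.1 hw⟩))
  have hvj : v ∈ S j := ⟨v⁻¹ * c, hvc, by rw [mul_inv_cancel_left]; exact hjc⟩
  have := (hconv j).le_of_minimalIn (hmin j) hvj
  rw [le_iff_sep_subset, hv] at this
  exact le_iff_sep_subset.2 (this.trans Set.inter_subset_left)

end GraphGroupPaper
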